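/- Let n ≥ 2, let 1 ≤ l < k ≤ n, α > 0, and set ϑ = 1/(k − l). Let λ ∈ Γ̃_k (so that S_k(λ) > 0 and S_l(λ) > 0), and let ξ = (ξ₁,…,ξ_n) ∈ ℝⁿ be arbitrary. Write A := (∑_{p=1}^n S_k^{pp}(λ) ξ_p)/S_k(λ) and B := (∑_{p=1}^n S_l^{pp}(λ) ξ_p)/S_l(λ). Then − (∑_{p,q=1}^n S_k^{pp,qq}(λ) ξ_p ξ_q)/S_k(λ) + (∑_{p,q=1}^n S_l^{pp,qq}(λ) ξ_p ξ_q)/S_l(λ) ≥ (A − B) · ((ϑ − 1) A − (ϑ + 1) B). -/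

import Mathlib

open scoped BigOperators

/-- The `k`-th elementary symmetric polynomial `σ_k(λ)` of `λ ∈ ℝⁿ`, indexed by `k : ℤ`,
with the conventions `σ₀ = 1` and `σ_k = 0` for `k < 0` or `k > n`. -/
noncomputable def esymmZ (n : ℕ) (k : ℤ) (lam : Fin n → ℝ) : ℝ :=
  if k < 0 then 0 else ∑ s ∈ Finset.univ.powersetCard k.toNat, ∏ i ∈ s, lam i

/-- `S_k(λ) := σ_k(λ) + α σ_{k-1}(λ)`. -/
noncomputable def SZ (n : ℕ) (α : ℝ) (k : ℤ) (lam : Fin n → ℝ) : ℝ :=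
  esymmZ n k lam + α * esymmZ n (k - 1) lam

/-- The Garding cone `Γ_m = {λ ∈ ℝⁿ : σ_j(λ) > 0 for j = 1,…,m}` (so `Γ₀ = ℝⁿ`). -/
def Gamma (n : ℕ) (m : ℕ) : Set (Fin n → ℝ) :=
  {lam | ∀ j : ℕ, 1 ≤ j → j ≤ m → 0 < esymmZ n j lam}

/-- `Γ̃_k := Γ_{k-1} ∩ {λ : S_k(λ) > 0}`. -/
def GammaTilde (n : ℕ) (α : ℝ) (k : ℕ) : Set (Fin n → ℝ) :=
  Gamma n (k - 1) ∩ {lam | 0 < SZ n α k lam}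

/-- `σ_k(λ|i)`: the `k`-th elementary symmetric polynomial of the vector obtained
from `λ` by deleting the entry `λ_i`. -/
noncomputable def esymmDel (n : ℕ) (k : ℤ) (lam : Fin n → ℝ) (i : Fin n) : ℝ :=
  if k < 0 then 0 else
    ∑ s ∈ (Finset.univ.erase i).powersetCard k.toNat, ∏ j ∈ s, lam j

/-- `S_k(λ|i) := σ_k(λ|i) + α σ_{k-1}(λ|i)`.  In particular
`S_k^{ii}(λ) = ∂S_k/∂λ_i = S_{k-1}(λ|i) = SDel n α (k-1) lam i`. -/
noncomputable def SDel (n : ℕ) (α : ℝ) (k : ℤ) (lam : Fin n → ℝ) (i : Fin n) : ℝ :=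
  esymmDel n k lam i + α * esymmDel n (k - 1) lam i

/-- `σ_k(λ|pq)`: the `k`-th elementary symmetric polynomial of the vector obtained
from `λ` by deleting the entries `λ_p` and `λ_q`. -/
noncomputable def esymmDel2 (n : ℕ) (k : ℤ) (lam : Fin n → ℝ) (p q : Fin n) : ℝ :=
  if k < 0 then 0 else
    ∑ s ∈ ((Finset.univ.erase p).erase q).powersetCard k.toNat, ∏ l ∈ s, lam l

/-- `S_k^{pp,qq}(λ) = ∂²S_k/∂λ_p∂λ_q`, which equals
`σ_{k-2}(λ|pq) + α σ_{k-3}(λ|pq)` for `p ≠ q`, and `0` for `p = q`. -/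
noncomputable def Spq (n : ℕ) (α : ℝ) (k : ℤ) (lam : Fin n → ℝ) (p q : Fin n) : ℝ :=
  if p = q then 0 else esymmDel2 n (k - 2) lam p q + α * esymmDel2 n (k - 3) lam p q

section ElementarySymmetric

variable {ι : Type*}

/-- The `m`-th elementary symmetric polynomial in the variables indexed by `s`. -/
noncomputable def esymmOn (x : ι → ℝ) (s : Finset ι) (m : ℕ) : ℝ :=
  ∑ t ∈ s.powersetCard m, ∏ i ∈ t, x i

@[simp] lemma esymmOn_zero (x : ι → ℝ) (s : Finset ι) : esymmOn x s 0 = 1 := by simp [esymmOn]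

lemma esymmOn_map {κ : Type*} (f : ι ↪ κ) (y : κ → ℝ) (s : Finset ι) (m : ℕ) :
    esymmOn y (s.map f) m = esymmOn (y ∘ f) s m := by
  simp only [esymmOn, Finset.powersetCard_map, Finset.sum_map, Finset.mapEmbedding_apply,
    Finset.prod_map, RelEmbedding.coe_toEmbedding, Function.comp_apply]

variable [DecidableEq ι]

/-- The first derivative of `esymmOn` at `x` in direction `ξ`. -/
noncomputable def esymmOnDeriv (x ξ : ι → ℝ) (s : Finset ι) : ℕ → ℝ
  | 0 => 0
  | m + 1 => ∑ i ∈ s, ξ i * esymmOn x (s.erase i) m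

/-- The second derivative of `esymmOn` at `x` in direction `ξ`. -/
noncomputable def esymmOnDeriv2 (x ξ : ι → ℝ) (s : Finset ι) : ℕ → ℝ
  | 0 => 0
  | m + 1 => ∑ i ∈ s, ξ i * esymmOnDeriv x ξ (s.erase i) m

variable (x ξ : ι → ℝ) (s : Finset ι)

@[simp] lemma esymmOnDeriv_zero : esymmOnDeriv x ξ s 0 = 0 := rfl

@[simp] lemma esymmOnDeriv2_zero : esymmOnDeriv2 x ξ s 0 = 0 := rfl

lemma esymmOnDeriv_succ (m : ℕ) :
    esymmOnDeriv x ξ s (m + 1) = ∑ i ∈ s, ξ i * esymmOn x (s.erase i) m := rfl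

lemma esymmOnDeriv2_succ (m : ℕ) :
    esymmOnDeriv2 x ξ s (m + 1) = ∑ i ∈ s, ξ i * esymmOnDeriv x ξ (s.erase i) m := rfl

variable {s} in
lemma esymmOn_succ {i : ι} (hi : i ∈ s) (m : ℕ) :
    esymmOn x s (m + 1) = esymmOn x (s.erase i) (m + 1) + x i * esymmOn x (s.erase i) m := by
  have h := Finset.notMem_erase i s
  conv_lhs => rw [← Finset.insert_erase hi, esymmOn, Finset.powersetCard_succ_insert h]
  rw [Finset.sum_union, Finset.sum_image, esymmOn, esymmOn, Finset.mul_sum]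
  · congr 1
    refine Finset.sum_congr rfl fun t ht => Finset.prod_insert fun hit => h ?_
    exact (Finset.mem_powersetCard.1 ht).1 hit
  · intro t ht t' ht' htt
    have ht := fun hit => h ((Finset.mem_powersetCard.1 ht).1 hit)
    have ht' := fun hit => h ((Finset.mem_powersetCard.1 ht').1 hit)
    rw [← Finset.erase_insert ht, ← Finset.erase_insert ht']
    exact congrArg (fun t => t.erase i) htt
  · rw [Finset.disjoint_left]
    intro t ht ht'
    obtain ⟨t', -, rfl⟩ := Finset.mem_image.1 ht'
    exact h ((Finset.mem_powersetCard.1 ht).1 (Finset.mem_insert_self _ _))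

variable {s} in
lemma esymmOnDeriv_succ_of_mem {i : ι} (hi : i ∈ s) (m : ℕ) :
    esymmOnDeriv x ξ s (m + 1) = esymmOnDeriv x ξ (s.erase i) (m + 1)
      + x i * esymmOnDeriv x ξ (s.erase i) m + ξ i * esymmOn x (s.erase i) m := by
  rw [esymmOnDeriv_succ, ← Finset.add_sum_erase s _ hi, esymmOnDeriv_succ]
  cases m with
  | zero => simp; ring
  | succ m =>
    rw [esymmOnDeriv_succ, Finset.mul_sum, ← Finset.sum_add_distrib, add_comm]
    congr 1
    refine Finset.sum_congr rfl fun j hj => ?_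
    have hij : i ∈ s.erase j := Finset.mem_erase.2 ⟨(Finset.ne_of_mem_erase hj).symm, hi⟩
    rw [esymmOn_succ x hij, Finset.erase_right_comm]
    ring

variable {s} in
lemma esymmOnDeriv2_succ_of_mem {i : ι} (hi : i ∈ s) (m : ℕ) :
    esymmOnDeriv2 x ξ s (m + 1) = esymmOnDeriv2 x ξ (s.erase i) (m + 1)
      + x i * esymmOnDeriv2 x ξ (s.erase i) m
      + 2 * ξ i * esymmOnDeriv x ξ (s.erase i) m := by
  rw [esymmOnDeriv2_succ, ← Finset.add_sum_erase s _ hi, esymmOnDeriv2_succ]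
  cases m with
  | zero => simp
  | succ m =>
    have key : ∑ j ∈ s.erase i, ξ j * esymmOnDeriv x ξ (s.erase j) (m + 1)
        = ∑ j ∈ s.erase i, ξ j * esymmOnDeriv x ξ ((s.erase i).erase j) (m + 1)
          + x i * esymmOnDeriv2 x ξ (s.erase i) (m + 1)
          + ξ i * esymmOnDeriv x ξ (s.erase i) (m + 1) := by
      rw [esymmOnDeriv2_succ, esymmOnDeriv_succ, Finset.mul_sum, Finset.mul_sum,
        ← Finset.sum_add_distrib, ← Finset.sum_add_distrib]
      refine Finset.sum_congr rfl fun j hj => ?_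
      have hij : i ∈ s.erase j := Finset.mem_erase.2 ⟨(Finset.ne_of_mem_erase hj).symm, hi⟩
      rw [esymmOnDeriv_succ_of_mem x ξ hij, Finset.erase_right_comm]
      ring
    rw [key]
    ring

lemma sum_erase_comm (f : ι → ι → ℝ) :
    ∑ i ∈ s, ∑ j ∈ s.erase i, f i j = ∑ j ∈ s, ∑ i ∈ s.erase j, f i j := by
  refine Finset.sum_comm' fun i j => ?_
  simp only [Finset.mem_erase]
  tauto

/-- Euler's identity for the elementary symmetric polynomials. -/
lemma succ_mul_esymmOn (m : ℕ) :
    ((m : ℝ) + 1) * esymmOn x s (m + 1) = ∑ i ∈ s, x i * esymmOn x (s.erase i) m := by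
  induction s using Finset.induction_on generalizing m with
  | empty => rw [esymmOn, Finset.powersetCard_eq_empty.2 (by simp)]; simp
  | insert a s ha ih =>
    have hmem := Finset.mem_insert_self a s
    rw [Finset.sum_insert ha, esymmOn_succ x hmem, Finset.erase_insert ha, mul_add, ih]
    have hne : ∀ i ∈ s, a ∈ (insert a s).erase i := fun i hi =>
      Finset.mem_erase.2 ⟨fun h => ha (h ▸ hi), hmem⟩
    have hcomm : ∀ i, ((insert a s).erase i).erase a = s.erase i := fun i => by
      rw [Finset.erase_right_comm, Finset.erase_insert ha]
    cases m with
    | zero => simp; ring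
    | succ m =>
      have key : ∑ i ∈ s, x i * esymmOn x ((insert a s).erase i) (m + 1)
          = ∑ i ∈ s, x i * esymmOn x (s.erase i) (m + 1)
            + x a * ∑ i ∈ s, x i * esymmOn x (s.erase i) m := by
        rw [Finset.mul_sum, ← Finset.sum_add_distrib]
        refine Finset.sum_congr rfl fun i hi => ?_
        rw [esymmOn_succ x (hne i hi), hcomm]
        ring
      rw [key, ← ih m]
      push_cast
      ring

lemma succ_mul_esymmOnDeriv (m : ℕ) :
    ((m : ℝ) + 1) * esymmOnDeriv x ξ s (m + 1)
      = ∑ i ∈ s, (x i * esymmOnDeriv x ξ (s.erase i) m + ξ i * esymmOn x (s.erase i) m) := by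
  rw [Finset.sum_add_distrib, ← esymmOnDeriv_succ]
  cases m with
  | zero => simp
  | succ m =>
    have key : ((m : ℝ) + 1) * esymmOnDeriv x ξ s (m + 1 + 1)
        = ∑ i ∈ s, x i * esymmOnDeriv x ξ (s.erase i) (m + 1) := by
      simp only [esymmOnDeriv_succ, Finset.mul_sum]
      rw [sum_erase_comm]
      refine Finset.sum_congr rfl fun i _ => ?_
      rw [mul_left_comm, succ_mul_esymmOn, Finset.mul_sum]
      refine Finset.sum_congr rfl fun j _ => ?_
      rw [Finset.erase_right_comm]
      ring
    rw [← key]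
    push_cast
    ring

lemma succ_mul_esymmOnDeriv2 (m : ℕ) :
    ((m : ℝ) + 1) * esymmOnDeriv2 x ξ s (m + 1)
      = ∑ i ∈ s, (x i * esymmOnDeriv2 x ξ (s.erase i) m
          + 2 * ξ i * esymmOnDeriv x ξ (s.erase i) m) := by
  have h2 : ∑ i ∈ s, 2 * ξ i * esymmOnDeriv x ξ (s.erase i) m
      = 2 * esymmOnDeriv2 x ξ s (m + 1) := by
    simp only [esymmOnDeriv2_succ, Finset.mul_sum, mul_assoc]
  rw [Finset.sum_add_distrib, h2]
  cases m with
  | zero => simp [esymmOnDeriv2_succ]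
  | succ m =>
    have key : ((m : ℝ) + 1) * esymmOnDeriv2 x ξ s (m + 1 + 1)
        = ∑ i ∈ s, x i * esymmOnDeriv2 x ξ (s.erase i) (m + 1)
          + esymmOnDeriv2 x ξ s (m + 1 + 1) := by
      have h3 : ∑ i ∈ s, x i * esymmOnDeriv2 x ξ (s.erase i) (m + 1)
          = ∑ i ∈ s, ξ i * ∑ j ∈ s.erase i, x j * esymmOnDeriv x ξ ((s.erase i).erase j) m := by
        simp only [esymmOnDeriv2_succ, Finset.mul_sum]
        rw [sum_erase_comm]
        refine Finset.sum_congr rfl fun i _ => Finset.sum_congr rfl fun j _ => ?_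
        rw [Finset.erase_right_comm]
        ring
      rw [h3, esymmOnDeriv2_succ, Finset.mul_sum, ← Finset.sum_add_distrib]
      refine Finset.sum_congr rfl fun i _ => ?_
      rw [mul_left_comm, succ_mul_esymmOnDeriv, Finset.sum_add_distrib, ← esymmOnDeriv_succ,
        mul_add]
    push_cast
    linarith

/-- The numerator of the second derivative of a quotient `A / D`, where `A, A', A''` and
`D, D', D''` are the values and the first two derivatives of `A` and `D`: the second derivative
equals `quotientDeriv2 / D ^ 3`. -/
def quotientDeriv2 (A A' A'' D D' D'' : ℝ) : ℝ :=
  A'' * D ^ 2 - A * D * D'' - 2 * A' * D' * D + 2 * A * D' ^ 2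

/-- If `u / v` is concave to second order and `0 < v`, `0 < D = u + a v` with `a` affine, then
`a u / D` is concave to second order. -/
lemma quotientDeriv2_affine_mul_nonpos {a b u u' u'' v v' v'' : ℝ} (hv : 0 < v)
    (hD : 0 < u + a * v) (h : quotientDeriv2 u u' u'' v v' v'' ≤ 0) :
    quotientDeriv2 (a * u) (a * u' + b * u) (a * u'' + 2 * b * u')
      (u + a * v) (u' + a * v' + b * v) (u'' + a * v'' + 2 * b * v') ≤ 0 := by
  refine nonpos_of_mul_nonpos_right (a := v) ?_ hv
  have key : v * quotientDeriv2 (a * u) (a * u' + b * u) (a * u'' + 2 * b * u')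
      (u + a * v) (u' + a * v' + b * v) (u'' + a * v'' + 2 * b * v')
      = a ^ 2 * (u + a * v) * quotientDeriv2 u u' u'' v v' v''
        - 2 * (v * (b * (u + a * v) - a * (u' + a * v' + b * v)) + a * (u + a * v) * v') ^ 2 := by
    unfold quotientDeriv2
    ring
  rw [key]
  have h1 : a ^ 2 * (u + a * v) * quotientDeriv2 u u' u'' v v' v'' ≤ 0 :=
    mul_nonpos_of_nonneg_of_nonpos (by positivity) h
  have h2 := sq_nonneg
    (v * (b * (u + a * v) - a * (u' + a * v' + b * v)) + a * (u + a * v) * v')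
  linarith

lemma esymmOnDeriv_single {i : ι} (hi : i ∈ s) (m : ℕ) :
    esymmOnDeriv x (Pi.single i 1) s (m + 1) = esymmOn x (s.erase i) m := by
  rw [esymmOnDeriv_succ, Finset.sum_eq_single_of_mem i hi]
  · simp
  · intro j _ hj
    simp [hj]

lemma esymmOnDeriv_single_of_notMem {i : ι} (hi : i ∉ s) (m : ℕ) :
    esymmOnDeriv x (Pi.single i 1) s m = 0 := by
  cases m with
  | zero => rfl
  | succ m =>
    refine Finset.sum_eq_zero fun j hj => ?_
    have : j ≠ i := fun h => hi (h ▸ hj)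
    simp [this]

lemma esymmOnDeriv2_single (i : ι) (m : ℕ) :
    esymmOnDeriv2 x (Pi.single i 1) s m = 0 := by
  cases m with
  | zero => rfl
  | succ m =>
    refine Finset.sum_eq_zero fun j _ => ?_
    by_cases hj : j = i
    · subst hj
      rw [esymmOnDeriv_single_of_notMem x _ (Finset.notMem_erase _ _), mul_zero]
    · simp [hj]

/-- Deleting a variable maps the Garding cone `Γ_m` to `Γ_{m-1}`, and `σ_{m+1} / σ_m` is concave
to second order on `Γ_m`. -/
lemma erase_pos_and_quotientDeriv2_nonpos (m : ℕ) :
    (∀ s : Finset ι, (∀ j ≤ m, 0 < esymmOn x s j) →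
      ∀ i ∈ s, ∀ j < m, 0 < esymmOn x (s.erase i) j) ∧
    (∀ (s : Finset ι) (ξ : ι → ℝ), (∀ j ≤ m, 0 < esymmOn x s j) →
      quotientDeriv2 (esymmOn x s (m + 1)) (esymmOnDeriv x ξ s (m + 1))
        (esymmOnDeriv2 x ξ s (m + 1)) (esymmOn x s m) (esymmOnDeriv x ξ s m)
        (esymmOnDeriv2 x ξ s m) ≤ 0) := by
  induction m with
  | zero => simp [quotientDeriv2, esymmOnDeriv2_succ]
  | succ m ih =>
    obtain ⟨ihpos, ihconc⟩ := ih
    have hpos : ∀ s : Finset ι, (∀ j ≤ m + 1, 0 < esymmOn x s j) →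
        ∀ i ∈ s, ∀ j < m + 1, 0 < esymmOn x (s.erase i) j := by
      intro s hs i hi j hj
      have hs' : ∀ j ≤ m, 0 < esymmOn x s j := fun j hj => hs j (by omega)
      rcases Nat.lt_succ_iff_lt_or_eq.1 hj with hj | rfl
      · exact ihpos s hs' i hi j hj
      · cases j with
        | zero => simp
        | succ j =>
          have hv := ihpos s hs' i hi j (by omega)
          have hA := hs (j + 1 + 1) le_rfl
          have hD := hs (j + 1) (by omega)
          have h := ihconc s (Pi.single i 1) hs'
          simp only [quotientDeriv2, esymmOnDeriv2_single, esymmOnDeriv_single x s hi] at h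
          have h' : esymmOn x (s.erase i) j * (esymmOn x s (j + 1 + 1) * esymmOn x (s.erase i) j)
              ≤ esymmOn x (s.erase i) j * (esymmOn x (s.erase i) (j + 1) * esymmOn x s (j + 1)) := by
            linarith
          exact pos_of_mul_pos_left
            ((mul_pos hA hv).trans_le (le_of_mul_le_mul_left h' hv)) hD.le
    refine ⟨hpos, fun s ξ hs => ?_⟩
    have hterm : ∀ i ∈ s, quotientDeriv2 (x i * esymmOn x (s.erase i) (m + 1))
        (x i * esymmOnDeriv x ξ (s.erase i) (m + 1) + ξ i * esymmOn x (s.erase i) (m + 1))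
        (x i * esymmOnDeriv2 x ξ (s.erase i) (m + 1)
          + 2 * ξ i * esymmOnDeriv x ξ (s.erase i) (m + 1))
        (esymmOn x s (m + 1)) (esymmOnDeriv x ξ s (m + 1)) (esymmOnDeriv2 x ξ s (m + 1)) ≤ 0 := by
      intro i hi
      have hp := hpos s hs i hi
      have hD := hs (m + 1) le_rfl
      rw [esymmOn_succ x hi] at hD ⊢
      rw [esymmOnDeriv_succ_of_mem x ξ hi, esymmOnDeriv2_succ_of_mem x ξ hi]
      exact quotientDeriv2_affine_mul_nonpos (hp m (by omega)) hD
        (ihconc (s.erase i) ξ fun j hj => hp j (by omega))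
    refine nonpos_of_mul_nonpos_right (a := ((m + 1 : ℕ) : ℝ) + 1) ?_ (by positivity)
    refine le_of_eq_of_le ?_ (Finset.sum_nonpos hterm)
    have e0 := succ_mul_esymmOn x s (m + 1)
    have e1 := succ_mul_esymmOnDeriv x ξ s (m + 1)
    have e2 := succ_mul_esymmOnDeriv2 x ξ s (m + 1)
    simp only [quotientDeriv2, Finset.sum_add_distrib, Finset.sum_sub_distrib, ← Finset.sum_mul,
      ← Finset.mul_sum] at e0 e1 e2 ⊢
    rw [← e2, ← e1, ← e0]
    ring

/-- `(σ_k / σ_l) ^ (1 / (k - l))` is concave to second order on the Garding cone `Γ_k`, in terms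
of its logarithmic derivatives. -/
lemma esymmOn_log_concave {l d : ℕ} (hs : ∀ j ≤ l + (d + 1), 0 < esymmOn x s j) :
    esymmOnDeriv2 x ξ s (l + (d + 1)) / esymmOn x s (l + (d + 1))
      - esymmOnDeriv2 x ξ s l / esymmOn x s l
      - (esymmOnDeriv x ξ s (l + (d + 1)) / esymmOn x s (l + (d + 1))) ^ 2
      + (esymmOnDeriv x ξ s l / esymmOn x s l) ^ 2
      + (esymmOnDeriv x ξ s (l + (d + 1)) / esymmOn x s (l + (d + 1))
          - esymmOnDeriv x ξ s l / esymmOn x s l) ^ 2 / ((d : ℝ) + 1) ≤ 0 := by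
  have step : ∀ m, (∀ j ≤ m + 1, 0 < esymmOn x s j) →
      esymmOnDeriv2 x ξ s (m + 1) / esymmOn x s (m + 1)
      - esymmOnDeriv2 x ξ s m / esymmOn x s m
      - (esymmOnDeriv x ξ s (m + 1) / esymmOn x s (m + 1)) ^ 2
      + (esymmOnDeriv x ξ s m / esymmOn x s m) ^ 2
      + (esymmOnDeriv x ξ s (m + 1) / esymmOn x s (m + 1)
          - esymmOnDeriv x ξ s m / esymmOn x s m) ^ 2 ≤ 0 := by
    intro m hs
    have h := (erase_pos_and_quotientDeriv2_nonpos x m).2 s ξ fun j hj => hs j (by omega)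
    have hA := hs (m + 1) le_rfl
    have hD := hs m (by omega)
    refine le_of_eq_of_le ?_ (div_nonpos_of_nonpos_of_nonneg h
      (by positivity : 0 ≤ esymmOn x s (m + 1) * esymmOn x s m ^ 2))
    unfold quotientDeriv2
    field_simp
    ring
  induction d with
  | zero => simpa using step l hs
  | succ d ih =>
    have h1 := ih fun j hj => hs j (by omega)
    have h2 := step (l + (d + 1)) hs
    rw [show l + (d + 1 + 1) = l + (d + 1) + 1 by ring]
    set r := esymmOnDeriv x ξ s l / esymmOn x s l
    set r₁ := esymmOnDeriv x ξ s (l + (d + 1)) / esymmOn x s (l + (d + 1))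
    set r₂ := esymmOnDeriv x ξ s (l + (d + 1) + 1) / esymmOn x s (l + (d + 1) + 1)
    have hd : (0 : ℝ) < (d : ℝ) + 1 := by positivity
    have key : (r₂ - r) ^ 2 / (((d + 1 : ℕ) : ℝ) + 1)
        ≤ (r₁ - r) ^ 2 / ((d : ℝ) + 1) + (r₂ - r₁) ^ 2 := by
      push_cast
      rw [div_add' _ _ _ hd.ne', div_le_div_iff₀ (by positivity) hd]
      nlinarith [sq_nonneg ((r₁ - r) - ((d : ℝ) + 1) * (r₂ - r₁))]
    linarith

lemma esymmOnDeriv_map {κ : Type*} [DecidableEq κ] (f : ι ↪ κ) (y η : κ → ℝ) (s : Finset ι)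
    (m : ℕ) : esymmOnDeriv y η (s.map f) m = esymmOnDeriv (y ∘ f) (η ∘ f) s m := by
  cases m with
  | zero => rfl
  | succ m => simp [esymmOnDeriv_succ, ← Finset.map_erase, esymmOn_map]

lemma esymmOnDeriv2_map {κ : Type*} [DecidableEq κ] (f : ι ↪ κ) (y η : κ → ℝ) (s : Finset ι)
    (m : ℕ) : esymmOnDeriv2 y η (s.map f) m = esymmOnDeriv2 (y ∘ f) (η ∘ f) s m := by
  cases m with
  | zero => rfl
  | succ m => simp [esymmOnDeriv2_succ, ← Finset.map_erase, esymmOnDeriv_map]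

end ElementarySymmetric

section AdjoinConstant

variable {n : ℕ} (α : ℝ) (lam ξ : Fin n → ℝ)

/-- `(λ, c)` as a vector indexed by `Option (Fin n)`. -/
def adjoinEntry (c : ℝ) (lam : Fin n → ℝ) : Option (Fin n) → ℝ := fun o => o.elim c lam

lemma erase_none_univ :
    (Finset.univ : Finset (Option (Fin n))).erase none
      = Finset.univ.map Function.Embedding.some := by
  ext o
  cases o <;> simp

lemma esymmZ_natCast (m : ℕ) : esymmZ n m lam = esymmOn lam Finset.univ m := by
  simp [esymmZ, esymmOn]

lemma esymmDel_natCast (m : ℕ) (p : Fin n) :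
    esymmDel n m lam p = esymmOn lam (Finset.univ.erase p) m := by
  simp [esymmDel, esymmOn]

lemma esymmDel2_natCast (m : ℕ) (p q : Fin n) :
    esymmDel2 n m lam p q = esymmOn lam ((Finset.univ.erase p).erase q) m := by
  simp [esymmDel2, esymmOn]

lemma sum_esymmDel (m : ℕ) :
    ∑ p, esymmDel n ((m : ℤ) - 1) lam p * ξ p = esymmOnDeriv lam ξ Finset.univ m := by
  cases m with
  | zero => simp [esymmDel]
  | succ m =>
    rw [esymmOnDeriv_succ, Nat.cast_succ, add_sub_cancel_right]
    exact Finset.sum_congr rfl fun p _ => by rw [esymmDel_natCast, mul_comm]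

lemma sum_esymmDel2 (m : ℕ) :
    ∑ p, ∑ q, (if p = q then 0 else esymmDel2 n ((m : ℤ) - 2) lam p q) * ξ p * ξ q
      = esymmOnDeriv2 lam ξ Finset.univ m := by
  rcases m with _ | _ | m
  · simp [esymmDel2]
  · simp [esymmDel2, esymmOnDeriv2_succ]
  · rw [esymmOnDeriv2_succ]
    refine Finset.sum_congr rfl fun p _ => ?_
    rw [esymmOnDeriv_succ, Finset.mul_sum, ← Finset.add_sum_erase _ _ (Finset.mem_univ p)]
    simp only [if_true, zero_mul, zero_add]
    refine Finset.sum_congr rfl fun q hq => ?_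
    rw [if_neg (Finset.ne_of_mem_erase hq).symm,
      show ((m + 1 + 1 : ℕ) : ℤ) - 2 = m by push_cast; ring, esymmDel2_natCast]
    ring

/-- `S_k(λ) = σ_k(λ, α)`. -/
lemma SZ_eq_esymmOn (m : ℕ) :
    SZ n α m lam = esymmOn (adjoinEntry α lam) Finset.univ m := by
  cases m with
  | zero => simp [SZ, esymmZ]
  | succ m =>
    rw [esymmOn_succ _ (Finset.mem_univ none), erase_none_univ, esymmOn_map, esymmOn_map, SZ,
      esymmZ_natCast, Nat.cast_succ, add_sub_cancel_right, esymmZ_natCast]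
    rfl

lemma sum_SDel_eq_esymmOnDeriv {m : ℕ} (hm : 1 ≤ m) :
    ∑ p, SDel n α ((m : ℤ) - 1) lam p * ξ p
      = esymmOnDeriv (adjoinEntry α lam) (adjoinEntry 0 ξ) Finset.univ m := by
  obtain ⟨m, rfl⟩ := Nat.exists_eq_add_of_le' hm
  rw [esymmOnDeriv_succ_of_mem _ _ (Finset.mem_univ none), erase_none_univ, esymmOnDeriv_map,
    esymmOnDeriv_map]
  have h1 := sum_esymmDel lam ξ (m + 1)
  have h2 := sum_esymmDel lam ξ m
  simp only [SDel, add_mul, Finset.sum_add_distrib, mul_assoc, ← Finset.mul_sum]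
  rw [h1, Nat.cast_succ, add_sub_cancel_right, h2]
  change _ = esymmOnDeriv lam ξ _ _ + α * esymmOnDeriv lam ξ _ _ + 0 * _
  ring

lemma sum_Spq_eq_esymmOnDeriv2 {m : ℕ} (hm : 1 ≤ m) :
    ∑ p, ∑ q, Spq n α m lam p q * ξ p * ξ q
      = esymmOnDeriv2 (adjoinEntry α lam) (adjoinEntry 0 ξ) Finset.univ m := by
  obtain ⟨m, rfl⟩ := Nat.exists_eq_add_of_le' hm
  rw [esymmOnDeriv2_succ_of_mem _ _ (Finset.mem_univ none), erase_none_univ, esymmOnDeriv2_map,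
    esymmOnDeriv2_map]
  have h1 := sum_esymmDel2 lam ξ (m + 1)
  have h2 := sum_esymmDel2 lam ξ m
  change _ = esymmOnDeriv2 lam ξ _ _ + α * esymmOnDeriv2 lam ξ _ _ + 2 * 0 * _
  rw [← h1, ← h2, mul_zero, zero_mul, add_zero, Finset.mul_sum, ← Finset.sum_add_distrib]
  refine Finset.sum_congr rfl fun p _ => ?_
  rw [Finset.mul_sum, ← Finset.sum_add_distrib]
  refine Finset.sum_congr rfl fun q _ => ?_
  rw [Spq, show ((m + 1 : ℕ) : ℤ) - 3 = m - 2 by push_cast; ring]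
  split_ifs <;> ring

end AdjoinConstant

theorem concavity_inequality_one
    (n : ℕ) (hn : 2 ≤ n) (l k : ℕ) (hl : 1 ≤ l) (hlk : l < k) (hkn : k ≤ n)
    (α : ℝ) (hα : 0 < α)
    (lam : Fin n → ℝ) (hlam : lam ∈ GammaTilde n α k)
    (ξ : Fin n → ℝ) (ϑ A B : ℝ)
    (hϑ : ϑ = 1 / ((k : ℝ) - (l : ℝ)))
    (hA : A = (∑ p : Fin n, SDel n α ((k : ℤ) - 1) lam p * ξ p) / SZ n α k lam)
    (hB : B = (∑ p : Fin n, SDel n α ((l : ℤ) - 1) lam p * ξ p) / SZ n α l lam) :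
    -(∑ p : Fin n, ∑ q : Fin n, Spq n α k lam p q * ξ p * ξ q) / SZ n α k lam
      + (∑ p : Fin n, ∑ q : Fin n, Spq n α l lam p q * ξ p * ξ q) / SZ n α l lam
    ≥ (A - B) * ((ϑ - 1) * A - (ϑ + 1) * B) := by
  have hpos : ∀ j ≤ k, 0 < esymmOn (adjoinEntry α lam) Finset.univ j := by
    have hσ : ∀ j, j ≤ k - 1 → 0 < esymmOn lam Finset.univ j := by
      intro j hj
      cases j with
      | zero => simp
      | succ j =>
        rw [← esymmZ_natCast]
        exact hlam.1 (j + 1) (by omega) hj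
    intro j hj
    rcases hj.lt_or_eq with hj | rfl
    · rw [← SZ_eq_esymmOn]
      cases j with
      | zero => simp [SZ, esymmZ]
      | succ j =>
        rw [SZ, esymmZ_natCast, Nat.cast_succ, add_sub_cancel_right, esymmZ_natCast]
        exact add_pos (hσ _ (by omega)) (mul_pos hα (hσ _ (by omega)))
    · rw [← SZ_eq_esymmOn]
      exact hlam.2
  obtain ⟨d, rfl⟩ : ∃ d, k = l + (d + 1) := ⟨k - l - 1, by omega⟩
  have h := esymmOn_log_concave (adjoinEntry α lam) (adjoinEntry 0 ξ) Finset.univ hpos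
  rw [sum_SDel_eq_esymmOnDeriv α lam ξ (by omega), SZ_eq_esymmOn] at hA
  rw [sum_SDel_eq_esymmOnDeriv α lam ξ hl, SZ_eq_esymmOn] at hB
  rw [sum_Spq_eq_esymmOnDeriv2 α lam ξ (by omega), sum_Spq_eq_esymmOnDeriv2 α lam ξ hl,
    SZ_eq_esymmOn, SZ_eq_esymmOn]
  rw [← hA, ← hB] at h
  have hd : (A - B) ^ 2 / ((d : ℝ) + 1) = ϑ * (A - B) ^ 2 := by
    rw [hϑ]
    push_cast
    rw [add_sub_cancel_left]
    ring
  rw [hd] at h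
  rw [neg_div]
  linarith
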